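/- If S is a set of positive integers with 1 ∈ S whose complement in the positive integers is infinite, then H(S) is an accumulation point of D = {H(S') : S' a set of positive integers with 1 ∈ S'} from the right: for every ε > 0 there exists S' ∈ G with H(S) < H(S') < H(S) + ε. Consequently, no gap of D has H(S) as its left endpoint. -/

import Mathlib

open scoped Classical

/-- `charFn S` is the characteristic function `u` of a set `S` of positive integers. -/
noncomputable def charFn (S : Set ℕ) (n : ℕ) : ℝ := if n ∈ S then 1 else 0

/-- `H S = ∏_p (1 + Σ_{i ≥ 2} (u(i) - u(i-1)) / p^i)`, the product over all primes. -/
noncomputable def H (S : Set ℕ) : ℝ :=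
  ∏' p : Nat.Primes,
    (1 + ∑' i : ℕ, (charFn S (i + 2) - charFn S (i + 1)) / ((p : ℕ) : ℝ) ^ (i + 2))

/-- The exponentially `S`-numbers: positive integers all of whose prime-factorization
exponents lie in `S`. -/
def ExpS (S : Set ℕ) : Set ℕ :=
  {N | 0 < N ∧ ∀ p : ℕ, p.Prime → p ∣ N → N.factorization p ∈ S}

/-- The set `D` of all densities `H S` as `S` ranges over sets of positive integers
containing `1`. -/
noncomputable def densitySet : Set ℝ :=
  {x | ∃ S : Set ℕ, 1 ∈ S ∧ (∀ n ∈ S, 0 < n) ∧ H S = x}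

/-- The power series `Σ_{i ≥ 1} u(i) x^i`. -/
noncomputable def charSeries (S : Set ℕ) (x : ℝ) : ℝ := ∑' i : ℕ, charFn S (i + 1) * x ^ (i + 1)

/-- The local factor of `H S` at `p`. -/
noncomputable def localFactor (S : Set ℕ) (p : Nat.Primes) : ℝ :=
  1 + ∑' i : ℕ, (charFn S (i + 2) - charFn S (i + 1)) / ((p : ℕ) : ℝ) ^ (i + 2)

lemma charFn_nonneg (S : Set ℕ) (n : ℕ) : 0 ≤ charFn S n := by
  unfold charFn; split_ifs <;> norm_num

lemma charFn_le_one (S : Set ℕ) (n : ℕ) : charFn S n ≤ 1 := by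
  unfold charFn; split_ifs <;> norm_num

lemma summable_charSeries (S : Set ℕ) {x : ℝ} (h0 : 0 ≤ x) (h : x < 1) :
    Summable fun i : ℕ => charFn S (i + 1) * x ^ (i + 1) :=
  Summable.of_nonneg_of_le (fun i => mul_nonneg (charFn_nonneg S _) (by positivity))
    (fun i => mul_le_of_le_one_left (by positivity) (charFn_le_one S _))
    ((summable_nat_add_iff 1).2 (summable_geometric_of_lt_one h0 h))

lemma charSeries_eq_add {S : Set ℕ} (h1 : 1 ∈ S) {x : ℝ} (h0 : 0 ≤ x) (h : x < 1) :
    charSeries S x = x + ∑' i : ℕ, charFn S (i + 2) * x ^ (i + 2) := by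
  rw [charSeries, (summable_charSeries S h0 h).tsum_eq_zero_add]
  simp [charFn, h1]

lemma le_charSeries {S : Set ℕ} (h1 : 1 ∈ S) {x : ℝ} (h0 : 0 ≤ x) (h : x < 1) :
    x ≤ charSeries S x := by
  rw [charSeries_eq_add h1 h0 h, le_add_iff_nonneg_right]
  exact tsum_nonneg fun i => mul_nonneg (charFn_nonneg S _) (by positivity)

lemma one_sub_mul_charSeries_le (S : Set ℕ) {x : ℝ} (h0 : 0 ≤ x) (h : x < 1) :
    (1 - x) * charSeries S x ≤ x := by
  have h2 : charSeries S x ≤ x * (1 - x)⁻¹ := by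
    rw [← tsum_geometric_of_lt_one h0 h, ← tsum_mul_left]
    refine (summable_charSeries S h0 h).tsum_le_tsum (fun i => ?_)
      ((summable_geometric_of_lt_one h0 h).mul_left x)
    rw [← pow_succ']
    exact mul_le_of_le_one_left (by positivity) (charFn_le_one S _)
  have h3 : 0 < 1 - x := by linarith
  rwa [← div_eq_mul_inv, le_div_iff₀ h3, mul_comm] at h2

lemma charSeries_insert {S : Set ℕ} {n : ℕ} (hn : n + 1 ∉ S) {x : ℝ} (h0 : 0 ≤ x) (h : x < 1) :
    charSeries (insert (n + 1) S) x = charSeries S x + x ^ (n + 1) := by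
  rw [charSeries, charSeries, ← tsum_ite_eq n (fun _ => x ^ (n + 1)),
    ← (summable_charSeries S h0 h).tsum_add (hasSum_ite_eq n (x ^ (n + 1))).summable]
  refine tsum_congr fun i => ?_
  by_cases hi : i = n
  · subst hi; simp [charFn, hn]
  · simp [charFn, hi]

lemma inv_prime_pos (p : Nat.Primes) : 0 < ((p : ℕ) : ℝ)⁻¹ :=
  inv_pos.2 (Nat.cast_pos.2 p.2.pos)

lemma inv_prime_le_half (p : Nat.Primes) : ((p : ℕ) : ℝ)⁻¹ ≤ 1 / 2 := by
  rw [one_div]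
  exact inv_anti₀ two_pos (by exact_mod_cast p.2.two_le)

lemma inv_prime_lt_one (p : Nat.Primes) : ((p : ℕ) : ℝ)⁻¹ < 1 :=
  (inv_prime_le_half p).trans_lt (by norm_num)

lemma summable_inv_prime_sq : Summable fun p : Nat.Primes => ((p : ℕ) : ℝ)⁻¹ ^ 2 := by
  have h : Summable fun n : ℕ => ((n : ℝ)⁻¹) ^ 2 := by
    simp [inv_pow]
  exact h.comp_injective Subtype.val_injective

lemma localFactor_eq {S : Set ℕ} (h1 : 1 ∈ S) (p : Nat.Primes) :
    localFactor S p = (1 - ((p : ℕ) : ℝ)⁻¹) * (1 + charSeries S ((p : ℕ) : ℝ)⁻¹) := by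
  have h0 := (inv_prime_pos p).le
  have h := inv_prime_lt_one p
  set x := ((p : ℕ) : ℝ)⁻¹ with hx
  have hs := summable_charSeries S h0 h
  have e : ∀ i : ℕ, (charFn S (i + 2) - charFn S (i + 1)) / ((p : ℕ) : ℝ) ^ (i + 2) =
      charFn S (i + 2) * x ^ (i + 2) - x * (charFn S (i + 1) * x ^ (i + 1)) := fun i => by
    rw [div_eq_mul_inv, ← inv_pow, ← hx]; ring
  rw [localFactor, tsum_congr e, ((summable_nat_add_iff 1).2 hs).tsum_sub (hs.mul_left x),
    tsum_mul_left]
  have h2 := charSeries_eq_add h1 h0 h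
  change 1 + (∑' i : ℕ, charFn S (i + 2) * x ^ (i + 2) - x * charSeries S x) = _
  linear_combination -h2

lemma abs_localFactor_sub_one_le {S : Set ℕ} (h1 : 1 ∈ S) (p : Nat.Primes) :
    |localFactor S p - 1| ≤ ((p : ℕ) : ℝ)⁻¹ ^ 2 := by
  have h0 := (inv_prime_pos p).le
  have h := inv_prime_lt_one p
  have hl := le_charSeries h1 h0 h
  have hu := one_sub_mul_charSeries_le S h0 h
  rw [localFactor_eq h1, abs_le]
  constructor <;> nlinarith

lemma localFactor_pos {S : Set ℕ} (h1 : 1 ∈ S) (p : Nat.Primes) : 0 < localFactor S p := by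
  have h0 := inv_prime_pos p
  have h := inv_prime_lt_one p
  have hl := le_charSeries h1 h0.le h
  rw [localFactor_eq h1]
  exact mul_pos (by linarith) (by linarith)

lemma summable_log_localFactor {S : Set ℕ} (h1 : 1 ∈ S) :
    Summable fun p => Real.log (localFactor S p) := by
  have h : Summable fun p => localFactor S p - 1 :=
    Summable.of_norm_bounded summable_inv_prime_sq (abs_localFactor_sub_one_le h1)
  simpa using Real.summable_log_one_add_of_summable h

lemma H_eq_exp {S : Set ℕ} (h1 : 1 ∈ S) :
    H S = Real.exp (∑' p, Real.log (localFactor S p)) :=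
  (Real.rexp_tsum_eq_tprod (localFactor_pos h1) (summable_log_localFactor h1)).symm

lemma log_localFactor_lt_insert {S : Set ℕ} (h1 : 1 ∈ S) {n : ℕ} (hn : n + 1 ∉ S)
    (p : Nat.Primes) :
    Real.log (localFactor S p) < Real.log (localFactor (insert (n + 1) S) p) := by
  have h0 := inv_prime_pos p
  have h := inv_prime_lt_one p
  refine Real.log_lt_log (localFactor_pos h1 p) ?_
  rw [localFactor_eq h1, localFactor_eq (Set.mem_insert_of_mem _ h1),
    charSeries_insert hn h0.le h]
  have := pow_pos h0 (n + 1)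
  exact mul_lt_mul_of_pos_left (by linarith) (by linarith)

lemma log_localFactor_insert_le {S : Set ℕ} (h1 : 1 ∈ S) {n : ℕ} (hn : n + 1 ∉ S)
    (p : Nat.Primes) :
    Real.log (localFactor (insert (n + 1) S) p) ≤
      Real.log (localFactor S p) + ((p : ℕ) : ℝ)⁻¹ ^ (n + 1) := by
  have h0 := inv_prime_pos p
  have h := inv_prime_lt_one p
  have hl := le_charSeries h1 h0.le h
  have hp := pow_pos h0 (n + 1)
  have hF := localFactor_pos h1 p
  rw [← Real.log_exp (((p : ℕ) : ℝ)⁻¹ ^ (n + 1)), ← Real.log_mul hF.ne' (Real.exp_pos _).ne']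
  refine Real.log_le_log (localFactor_pos (Set.mem_insert_of_mem _ h1) p) ?_
  refine le_trans ?_ (mul_le_mul_of_nonneg_left (Real.add_one_le_exp _) hF.le)
  rw [localFactor_eq h1, localFactor_eq (Set.mem_insert_of_mem _ h1),
    charSeries_insert hn h0.le h, mul_assoc]
  refine mul_le_mul_of_nonneg_left ?_ (by linarith)
  nlinarith

lemma tsum_log_localFactor_lt_insert {S : Set ℕ} (h1 : 1 ∈ S) {n : ℕ} (hn : n + 1 ∉ S) :
    ∑' p, Real.log (localFactor S p) < ∑' p, Real.log (localFactor (insert (n + 1) S) p) :=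
  Summable.tsum_lt_tsum (i := ⟨2, Nat.prime_two⟩)
    (fun p => (log_localFactor_lt_insert h1 hn p).le) (log_localFactor_lt_insert h1 hn _)
    (summable_log_localFactor h1) (summable_log_localFactor (Set.mem_insert_of_mem _ h1))

lemma tsum_log_localFactor_insert_le {S : Set ℕ} (h1 : 1 ∈ S) {n : ℕ} (hn : n + 3 ∉ S) :
    ∑' p, Real.log (localFactor (insert (n + 3) S) p) ≤
      ∑' p, Real.log (localFactor S p) +
        (1 / 2) ^ n * ∑' p : Nat.Primes, ((p : ℕ) : ℝ)⁻¹ ^ 2 := by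
  have hs := summable_inv_prime_sq.mul_left ((1 / 2 : ℝ) ^ n)
  rw [← tsum_mul_left, ← (summable_log_localFactor h1).tsum_add hs]
  refine (summable_log_localFactor (Set.mem_insert_of_mem _ h1)).tsum_le_tsum (fun p => ?_)
    ((summable_log_localFactor h1).add hs)
  refine (log_localFactor_insert_le (n := n + 2) h1 hn p).trans ?_
  have h0 := (inv_prime_pos p).le
  have h := pow_le_pow_left₀ h0 (inv_prime_le_half p) n
  have h' := pow_le_one₀ (n := 1) h0 (inv_prime_lt_one p).le
  gcongr
  calc ((p : ℕ) : ℝ)⁻¹ ^ (n + 2 + 1)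
      = ((p : ℕ) : ℝ)⁻¹ ^ n * ((p : ℕ) : ℝ)⁻¹ ^ 2 * ((p : ℕ) : ℝ)⁻¹ ^ 1 := by ring
    _ ≤ ((p : ℕ) : ℝ)⁻¹ ^ n * ((p : ℕ) : ℝ)⁻¹ ^ 2 := mul_le_of_le_one_right (by positivity) h'
    _ ≤ (1 / 2) ^ n * ((p : ℕ) : ℝ)⁻¹ ^ 2 := by gcongr

theorem acc_from_right (S : Set ℕ) (h1 : 1 ∈ S) (hpos : ∀ n ∈ S, 0 < n)
    (hinf : ({n : ℕ | 0 < n} \ S).Infinite) :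
    ∀ ε : ℝ, 0 < ε → ∃ S' : Set ℕ, 1 ∈ S' ∧ (∀ n ∈ S', 0 < n) ∧
      H S < H S' ∧ H S' < H S + ε := by
  intro ε hε
  set L := ∑' p, Real.log (localFactor S p)
  set C := ∑' p : Nat.Primes, ((p : ℕ) : ℝ)⁻¹ ^ 2
  have hlim : Filter.Tendsto (fun n : ℕ => Real.exp (L + (1 / 2) ^ n * C)) Filter.atTop
      (nhds (Real.exp L)) := by
    have := ((tendsto_pow_atTop_nhds_zero_of_lt_one (r := (1 / 2 : ℝ)) (by norm_num)
      (by norm_num)).mul_const C).const_add L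
    rw [zero_mul, add_zero] at this
    exact (Real.continuous_exp.tendsto L).comp this
  obtain ⟨N, hN⟩ := Filter.eventually_atTop.1
    (hlim.eventually_lt_const (lt_add_of_pos_right (Real.exp L) hε))
  obtain ⟨m, ⟨-, hmS⟩, hm⟩ := hinf.exists_gt (N + 3)
  obtain ⟨n, rfl⟩ := Nat.exists_eq_add_of_le' (show 3 ≤ m by omega)
  have h1' : 1 ∈ insert (n + 3) S := Set.mem_insert_of_mem _ h1
  refine ⟨insert (n + 3) S, h1', ?_, ?_, ?_⟩
  · rintro k (rfl | hk)
    · omega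
    · exact hpos k hk
  · rw [H_eq_exp h1, H_eq_exp h1', Real.exp_lt_exp]
    exact tsum_log_localFactor_lt_insert (n := n + 2) h1 hmS
  · rw [H_eq_exp h1, H_eq_exp h1']
    exact (Real.exp_le_exp.2 (tsum_log_localFactor_insert_le h1 hmS)).trans_lt (hN n (by omega))
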